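/- For every p ∈ [1, ∞) there exist constants 0 < c_p ≤ C_p < ∞, depending only on p, such that for every probability space (Ω, F, P), every filtration (F_n)_{n∈ℕ}, every discrete-time martingale (X_n) with respect to (F_n) satisfying X_0 = 0, and every N ∈ ℕ: c_p · E[ S_N^p ] ≤ E[ (max_{0 ≤ n ≤ N} |X_n|)^p ] ≤ C_p · E[ S_N^p ], where S_N = ( Σ_{k=1}^{N} (X_k − X_{k−1})^2 )^{1/2} is the square root of the quadratic variation. (Burkholder–Davis–Gundy inequalities, discrete time.) -/

import Mathlib

open MeasureTheory Filter Topology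
open scoped NNReal ENNReal

namespace BurkholderDavisGundy

/-- One step of the potential argument bounding the square function by the running maximum:
`s - x² / s - 8 M` decreases at least as fast as `2 (x / s) Δ`. -/
lemma sqrt_potential_step {x d M q s M' s' : ℝ} (hx : |x| ≤ M) (hq : 0 ≤ q)
    (hs0 : 0 ≤ s) (hs : s ^ 2 = q + M ^ 2) (hM' : M' = max M |x + d|)
    (hs0' : 0 ≤ s') (hs' : s' ^ 2 = q + d ^ 2 + M' ^ 2) :
    s' - (x + d) ^ 2 / s' - 8 * M' ≤ s - x ^ 2 / s - 8 * M - 2 * (x / s * d) := by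
  have hM : 0 ≤ M := (abs_nonneg x).trans hx
  have hxM' : |x + d| ≤ M' := hM' ▸ le_max_right _ _
  have hMM' : M ≤ M' := hM' ▸ le_max_left _ _
  rcases hs0.eq_or_lt with h0 | hpos
  · subst h0
    have hM0 : M = 0 := by nlinarith
    have hq0 : q = 0 := by nlinarith
    subst hM0 hq0
    have hx0 : x = 0 := abs_nonpos_iff.mp hx
    subst hx0
    have h1 : 0 ≤ (0 + d) ^ 2 / s' := by positivity
    have h2 : d ^ 2 ≤ M' ^ 2 := by
      have := sq_le_sq' (by linarith [abs_nonneg (0 + d)]) hxM'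
      simpa using this
    have h3 : s' ≤ 8 * M' := by nlinarith
    simp only [div_zero, zero_mul, mul_zero] at *
    linarith
  have hxs : x ^ 2 ≤ M ^ 2 := sq_le_sq.mpr (by rwa [abs_of_nonneg hM])
  have hxs' : (x + d) ^ 2 ≤ M' ^ 2 := sq_le_sq.mpr (by rwa [abs_of_nonneg (hM.trans hMM')])
  have hss' : s ≤ s' := by nlinarith [sq_nonneg d]
  have hpos' : 0 < s' := hpos.trans_le hss'
  have hMs : M ≤ s := by nlinarith
  have key : 0 ≤ (d ^ 2 - (x + d) ^ 2) * s' + (x + d) ^ 2 * s - (s' - s) * s * s'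
      + 8 * (M' - M) * s * s' := by
    rcases le_total |x + d| M with h | h
    · have hMM : M' = M := by rw [hM', max_eq_left h]
      subst hMM
      have e : d ^ 2 = (s' - s) * (s' + s) := by linarith
      have : 0 ≤ (s' - s) * (s' ^ 2 - (x + d) ^ 2) :=
        mul_nonneg (by linarith) (by nlinarith [sq_nonneg d])
      rw [e]; linarith
    · have hMM : M' = |x + d| := by rw [hM', max_eq_right h]
      have e : d ^ 2 = (s' - s) * (s' + s) - (M' - M) * (M' + M) := by linarith
      have h1 : 0 ≤ (s' - s) * (s' ^ 2 - (x + d) ^ 2) :=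
        mul_nonneg (by linarith) (by nlinarith [sq_nonneg d])
      rcases le_total M' (7 * s) with h7 | h7
      · have h2 : 0 ≤ ((M' - M) * s') * (8 * s - M' - M) :=
          mul_nonneg (mul_nonneg (by linarith) hpos'.le) (by linarith)
        have e2 : (d ^ 2 - (x + d) ^ 2) * s' + (x + d) ^ 2 * s - (s' - s) * s * s'
            + 8 * (M' - M) * s * s' = (s' - s) * (s' ^ 2 - (x + d) ^ 2)
            + ((M' - M) * s') * (8 * s - M' - M) := by
          rw [e]; ring
        linarith
      · have hd : d ^ 2 ≤ (M' + M) ^ 2 := by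
          apply sq_le_sq.mpr
          rw [abs_of_nonneg (a := M' + M) (by linarith)]
          have := abs_sub (x + d) x
          have e3 : x + d - x = d := by ring
          rw [e3] at this
          linarith
        have hs2 : s' ≤ 2 * M' := by nlinarith
        have hx1 : |x * (x + d)| ≤ s * M' := by
          rw [abs_mul]
          exact mul_le_mul (hx.trans hMs) hxM' (abs_nonneg _) hpos.le
        have hx2 := (abs_le.mp hx1).2
        have h2 : 0 ≤ (s * s') * (-2 * M' - s' + 8 * (M' - M)) :=
          mul_nonneg (by positivity) (by linarith)
        have h3 : 0 ≤ s' * (s * M' - x * (x + d)) := mul_nonneg hpos'.le (by linarith)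
        have h4 : 0 ≤ x ^ 2 * s' := by positivity
        have h5 : 0 ≤ (x + d) ^ 2 * s := by positivity
        have h6 : 0 ≤ s ^ 2 * s' := by positivity
        nlinarith
  have e : s - x ^ 2 / s - 8 * M - 2 * (x / s * d) - (s' - (x + d) ^ 2 / s' - 8 * M')
      = ((d ^ 2 - (x + d) ^ 2) * s' + (x + d) ^ 2 * s - (s' - s) * s * s'
      + 8 * (M' - M) * s * s') / (s * s') := by
    field_simp
    ring
  have := div_nonneg key (mul_pos hpos hpos').le
  linarith

/-- One step of the potential argument bounding the running maximum by the square function: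
`(x² + r²) / s + s - 12 r` increases at most as fast as `2 (x / s) Δ`. -/
lemma max_potential_step {x d M r s M' r' s' : ℝ} (hx : |x| ≤ M) (hr0 : 0 ≤ r)
    (hs0 : 0 ≤ s) (hs : s ^ 2 = r ^ 2 + M ^ 2) (hM' : M' = max M |x + d|)
    (hr0' : 0 ≤ r') (hr' : r' ^ 2 = r ^ 2 + d ^ 2)
    (hs0' : 0 ≤ s') (hs' : s' ^ 2 = r' ^ 2 + M' ^ 2) :
    ((x + d) ^ 2 + r' ^ 2) / s' + s' - 12 * r'
      ≤ (x ^ 2 + r ^ 2) / s + s - 12 * r + 2 * (x / s * d) := by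
  have hM : 0 ≤ M := (abs_nonneg x).trans hx
  have hxM' : |x + d| ≤ M' := hM' ▸ le_max_right _ _
  have hMM' : M ≤ M' := hM' ▸ le_max_left _ _
  have hxs : x ^ 2 ≤ M ^ 2 := sq_le_sq.mpr (by rwa [abs_of_nonneg hM])
  have hxs' : (x + d) ^ 2 ≤ M' ^ 2 := sq_le_sq.mpr (by rwa [abs_of_nonneg (hM.trans hMM')])
  have hrr' : r ≤ r' := by nlinarith [sq_nonneg d]
  have hdr' : |d| ≤ r' := abs_le_of_sq_le_sq (by nlinarith) hr0'
  have hM'd : M' ≤ M + |d| := by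
    rw [hM']
    refine max_le (by linarith [abs_nonneg d]) ((abs_add_le x d).trans (by linarith))
  rcases hs0.eq_or_lt with h0 | hpos
  · subst h0
    have hM0 : M = 0 := by nlinarith
    have hq0 : r = 0 := by nlinarith
    subst hM0 hq0
    have hx0 : x = 0 := abs_nonpos_iff.mp hx
    subst hx0
    have h1 : ((0 + d) ^ 2 + r' ^ 2) / s' ≤ s' := by
      apply div_le_of_le_mul₀ hs0' hs0'
      nlinarith
    have h3 : s' ≤ 6 * r' := by nlinarith
    simp only [div_zero, zero_mul, mul_zero] at *
    linarith
  have hss' : s ≤ s' := by nlinarith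
  have hpos' : 0 < s' := hpos.trans_le hss'
  have hMs : M ≤ s := by nlinarith
  have hrs : r ≤ s := by nlinarith
  have key : 0 ≤ (2 * (x * d) + x ^ 2 + r ^ 2) * s' - ((x + d) ^ 2 + r' ^ 2) * s
      - (s' - s - 12 * (r' - r)) * s * s' := by
    rcases le_total r' (2 * s) with h2 | h2
    · have hd2 : d ^ 2 * s' ≤ 4 * (r' - r) * s * s' := by
        apply mul_le_mul_of_nonneg_right _ hpos'.le
        nlinarith
      have hds : d ^ 2 * s ≤ d ^ 2 * s' := mul_le_mul_of_nonneg_left hss' (sq_nonneg d)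
      have hmain : -(d ^ 2 * s') ≤ ((x + d) ^ 2 + r ^ 2) * (s' - s) - (s' - s) * s * s' := by
        rcases le_total |x + d| M with h | h
        · have hMM : M' = M := by rw [hM', max_eq_left h]
          subst hMM
          have e : (s' - s) * (s' + s) = d ^ 2 := by linarith
          have h3 : 0 ≤ ((x + d) ^ 2 + r ^ 2) * (s' - s) :=
            mul_nonneg (by positivity) (by linarith)
          have h4 : (s' - s) * s * s' ≤ d ^ 2 * s' := by
            apply mul_le_mul_of_nonneg_right _ hpos'.le
            nlinarith
          linarith
        · have hMM : M' = |x + d| := by rw [hM', max_eq_right h]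
          have e : (x + d) ^ 2 + r ^ 2 = s' ^ 2 - d ^ 2 := by
            rw [← sq_abs (x + d), ← hMM]; linarith
          rw [e]
          have h3 : 0 ≤ (s' - s) * (s' - s) * s' := mul_nonneg (mul_self_nonneg _) hpos'.le
          have h4 : 0 ≤ d ^ 2 * s := by positivity
          linarith
      have e2 : (2 * (x * d) + x ^ 2 + r ^ 2) * s' - ((x + d) ^ 2 + r' ^ 2) * s
          - (s' - s - 12 * (r' - r)) * s * s' = ((x + d) ^ 2 + r ^ 2) * (s' - s)
          - (s' - s) * s * s' - d ^ 2 * s' - d ^ 2 * s + 12 * (r' - r) * s * s' := by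
        rw [hr']; ring
      linarith
    · have hs2 : s' ≤ 2 * r' := by nlinarith [abs_nonneg d]
      have hxd : |x * d| ≤ s * r' := by
        rw [abs_mul]
        exact mul_le_mul (hx.trans hMs) hdr' (abs_nonneg _) hpos.le
      have h3 : 0 ≤ (s * r' + x * d) * s' :=
        mul_nonneg (by linarith [(abs_le.mp hxd).1]) hpos'.le
      have h4 : 0 ≤ (s' ^ 2 - ((x + d) ^ 2 + r' ^ 2)) * s := mul_nonneg (by linarith) hpos.le
      have h5 : 0 ≤ (s * s') * (-2 * r' - 2 * s' + 12 * (r' - r)) :=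
        mul_nonneg (by positivity) (by linarith)
      have h6 : 0 ≤ (x ^ 2 + r ^ 2) * s' := by positivity
      have h7 : 0 ≤ s ^ 2 * s' := by positivity
      nlinarith
  have e : (x ^ 2 + r ^ 2) / s + s - 12 * r + 2 * (x / s * d)
      - (((x + d) ^ 2 + r' ^ 2) / s' + s' - 12 * r')
      = ((2 * (x * d) + x ^ 2 + r ^ 2) * s' - ((x + d) ^ 2 + r' ^ 2) * s
      - (s' - s - 12 * (r' - r)) * s * s') / (s * s') := by
    field_simp
    ring
  have := div_nonneg key (mul_pos hpos hpos').le
  linarith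

/-- The quadratic variation of a real sequence. -/
def quadVar (x : ℕ → ℝ) (n : ℕ) : ℝ := ∑ i ∈ Finset.range n, (x (i + 1) - x i) ^ 2

/-- The running maximum of the absolute value of a real sequence. -/
def runMax (x : ℕ → ℝ) : ℕ → ℝ
  | 0 => |x 0|
  | n + 1 => max (runMax x n) |x (n + 1)|

/-- The bounded integrand `x / √([x] + (x^*)²)` that compares the square function with the
running maximum. -/
noncomputable def integrand (x : ℕ → ℝ) (n : ℕ) : ℝ := x n / √(quadVar x n + runMax x n ^ 2)

/-- The increments of a sequence after time `j`. -/
def restart (x : ℕ → ℝ) (j l : ℕ) : ℝ := x (j + l) - x j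

lemma quadVar_succ (x : ℕ → ℝ) (n : ℕ) :
    quadVar x (n + 1) = quadVar x n + (x (n + 1) - x n) ^ 2 :=
  Finset.sum_range_succ _ _

lemma quadVar_nonneg (x : ℕ → ℝ) (n : ℕ) : 0 ≤ quadVar x n :=
  Finset.sum_nonneg fun _ _ => sq_nonneg _

lemma quadVar_mono (x : ℕ → ℝ) : Monotone (quadVar x) :=
  monotone_nat_of_le_succ fun n => by rw [quadVar_succ]; linarith [sq_nonneg (x (n + 1) - x n)]

lemma runMax_mono (x : ℕ → ℝ) : Monotone (runMax x) :=
  monotone_nat_of_le_succ fun _ => le_max_left _ _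

lemma abs_le_runMax_self (x : ℕ → ℝ) (n : ℕ) : |x n| ≤ runMax x n := by
  cases n with
  | zero => exact le_rfl
  | succ n => exact le_max_right _ _

lemma abs_le_runMax (x : ℕ → ℝ) {n N : ℕ} (h : n ≤ N) : |x n| ≤ runMax x N :=
  (abs_le_runMax_self x n).trans (runMax_mono x h)

lemma runMax_nonneg (x : ℕ → ℝ) (n : ℕ) : 0 ≤ runMax x n :=
  (abs_nonneg _).trans (abs_le_runMax_self x n)

lemma runMax_le {x : ℕ → ℝ} {N : ℕ} {a : ℝ} (h : ∀ n ≤ N, |x n| ≤ a) : runMax x N ≤ a := by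
  induction N with
  | zero => exact h 0 le_rfl
  | succ N ih => exact max_le (ih fun n hn => h n (hn.trans N.le_succ)) (h _ le_rfl)

lemma iSup_abs_eq_runMax (x : ℕ → ℝ) (N : ℕ) : ⨆ n ∈ Set.Iic N, |x n| = runMax x N := by
  have hle : ∀ n, ⨆ _ : n ∈ Set.Iic N, |x n| ≤ runMax x N := fun n =>
    Real.iSup_le (fun hn => abs_le_runMax x hn) (runMax_nonneg x N)
  refine le_antisymm (Real.iSup_le hle (runMax_nonneg x N)) (runMax_le fun n hn => ?_)
  refine le_ciSup_of_le ⟨runMax x N, by rintro _ ⟨n, rfl⟩; exact hle n⟩ n ?_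
  exact le_ciSup (f := fun _ : n ∈ Set.Iic N => |x n|)
    ⟨|x n|, by rintro _ ⟨_, rfl⟩; exact le_rfl⟩ hn

lemma abs_integrand_le_one (x : ℕ → ℝ) (n : ℕ) : |integrand x n| ≤ 1 := by
  rw [integrand, abs_div, abs_of_nonneg (Real.sqrt_nonneg _)]
  refine div_le_one_of_le₀ (Real.le_sqrt_of_sq_le ?_) (Real.sqrt_nonneg _)
  have := pow_le_pow_left₀ (abs_nonneg _) (abs_le_runMax_self x n) 2
  linarith [quadVar_nonneg x n]

lemma sqrt_quadVar_le {x : ℕ → ℝ} (hx : x 0 = 0) (n : ℕ) :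
    √(quadVar x n) ≤ 9 * runMax x n
      - 2 * ∑ k ∈ Finset.range n, integrand x k * (x (k + 1) - x k) := by
  have potential : ∀ n, √(quadVar x n + runMax x n ^ 2)
      - x n ^ 2 / √(quadVar x n + runMax x n ^ 2) - 8 * runMax x n
      ≤ - 2 * ∑ k ∈ Finset.range n, integrand x k * (x (k + 1) - x k) := by
    intro n
    induction n with
    | zero => simp [quadVar, runMax, hx]
    | succ n ih =>
      have hq := quadVar_nonneg x n
      have hq' := quadVar_nonneg x (n + 1)
      have step := sqrt_potential_step (x := x n) (d := x (n + 1) - x n)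
        (abs_le_runMax_self x n) hq (Real.sqrt_nonneg _)
        (Real.sq_sqrt (add_nonneg hq (sq_nonneg (runMax x n)))) (M' := runMax x (n + 1))
        (by rw [add_sub_cancel]; rfl) (Real.sqrt_nonneg _)
        (by rw [← quadVar_succ]; exact Real.sq_sqrt (add_nonneg hq' (sq_nonneg _)))
      rw [add_sub_cancel] at step
      rw [Finset.sum_range_succ]
      simp only [integrand] at ih ⊢
      linarith
  have hn := potential n
  have h1 : √(quadVar x n) ≤ √(quadVar x n + runMax x n ^ 2) :=
    Real.sqrt_le_sqrt (by linarith [sq_nonneg (runMax x n)])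
  have h2 : x n ^ 2 / √(quadVar x n + runMax x n ^ 2) ≤ runMax x n := by
    have hM : runMax x n ≤ √(quadVar x n + runMax x n ^ 2) :=
      Real.le_sqrt_of_sq_le (by linarith [quadVar_nonneg x n])
    apply div_le_of_le_mul₀ (Real.sqrt_nonneg _) (runMax_nonneg x n)
    have := pow_le_pow_left₀ (abs_nonneg _) (abs_le_runMax_self x n) 2
    rw [sq_abs] at this
    nlinarith [runMax_nonneg x n]
  linarith

lemma runMax_le_sqrt_quadVar {x : ℕ → ℝ} (hx : x 0 = 0) (n : ℕ) :
    runMax x n ≤ 12 * √(quadVar x n)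
      + 2 * ∑ k ∈ Finset.range n, integrand x k * (x (k + 1) - x k) := by
  have potential : ∀ n, (x n ^ 2 + √(quadVar x n) ^ 2) / √(quadVar x n + runMax x n ^ 2)
      + √(quadVar x n + runMax x n ^ 2) - 12 * √(quadVar x n)
      ≤ 2 * ∑ k ∈ Finset.range n, integrand x k * (x (k + 1) - x k) := by
    intro n
    induction n with
    | zero => simp [quadVar, runMax, hx]
    | succ n ih =>
      have hq := quadVar_nonneg x n
      have hq' := quadVar_nonneg x (n + 1)
      have step := max_potential_step (x := x n) (d := x (n + 1) - x n)
        (r := √(quadVar x n)) (r' := √(quadVar x (n + 1)))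
        (s := √(quadVar x n + runMax x n ^ 2))
        (s' := √(quadVar x (n + 1) + runMax x (n + 1) ^ 2))
        (abs_le_runMax_self x n) (Real.sqrt_nonneg _) (Real.sqrt_nonneg _)
        (by rw [Real.sq_sqrt (add_nonneg hq (sq_nonneg _)), Real.sq_sqrt hq])
        (M' := runMax x (n + 1))
        (by rw [add_sub_cancel]; rfl) (Real.sqrt_nonneg _)
        (by rw [Real.sq_sqrt hq, Real.sq_sqrt hq', quadVar_succ]) (Real.sqrt_nonneg _)
        (by rw [Real.sq_sqrt (add_nonneg hq' (sq_nonneg _)), Real.sq_sqrt hq'])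
      rw [add_sub_cancel] at step
      rw [Finset.sum_range_succ]
      simp only [integrand] at ih ⊢
      linarith
  have hn := potential n
  have h1 : runMax x n ≤ √(quadVar x n + runMax x n ^ 2) :=
    Real.le_sqrt_of_sq_le (by linarith [quadVar_nonneg x n])
  have h2 : 0 ≤ (x n ^ 2 + √(quadVar x n) ^ 2) / √(quadVar x n + runMax x n ^ 2) := by
    positivity
  linarith

@[simp] lemma restart_zero (x : ℕ → ℝ) (j : ℕ) : restart x j 0 = 0 := by simp [restart]

@[simp] lemma integrand_restart_zero (x : ℕ → ℝ) (j : ℕ) : integrand (restart x j) 0 = 0 := by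
  simp [integrand]

lemma restart_succ_sub (x : ℕ → ℝ) (j l : ℕ) :
    restart x j (l + 1) - restart x j l = x (j + l + 1) - x (j + l) := by
  simp [restart, add_assoc]

lemma quadVar_add (x : ℕ → ℝ) (j l : ℕ) :
    quadVar x (j + l) = quadVar x j + quadVar (restart x j) l := by
  simp only [quadVar, restart_succ_sub, Finset.sum_range_add]

lemma runMax_restart_le (x : ℕ → ℝ) (j l : ℕ) :
    runMax (restart x j) l ≤ 2 * runMax x (j + l) :=
  runMax_le fun n hn => by
    have h1 := abs_le_runMax x (show j + n ≤ j + l by lia)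
    have h2 := abs_le_runMax x (show j ≤ j + l by lia)
    exact (abs_sub _ _).trans (by linarith)

lemma runMax_add_le (x : ℕ → ℝ) (j l : ℕ) :
    runMax x (j + l) ≤ runMax x j + runMax (restart x j) l := by
  refine runMax_le fun n hn => ?_
  rcases le_total n j with h | h
  · linarith [abs_le_runMax x h, runMax_nonneg (restart x j) l]
  · obtain ⟨k, rfl⟩ := Nat.exists_eq_add_of_le h
    have h1 := abs_le_runMax (restart x j) (show k ≤ l by lia)
    have h2 := abs_add_le (restart x j k) (x j)
    rw [restart, sub_add_cancel] at h2
    linarith [abs_le_runMax_self x j, show |restart x j k| = |x (j + k) - x j| from rfl]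

lemma sqrt_quadVar_sub_le (x : ℕ → ℝ) (j l : ℕ) :
    √(quadVar x (j + l)) - √(quadVar x j) ≤ 18 * runMax x (j + l)
      + ∑ k ∈ Finset.range l,
        -2 * integrand (restart x j) k * (x (j + k + 1) - x (j + k)) := by
  have h := sqrt_quadVar_le (restart_zero x j) l
  have h1 : √(quadVar x (j + l)) ≤ √(quadVar x j) + √(quadVar (restart x j) l) := by
    rw [quadVar_add]
    have hq := Real.sq_sqrt (quadVar_nonneg x j)
    have hr := Real.sq_sqrt (quadVar_nonneg (restart x j) l)
    refine Real.sqrt_le_iff.mpr ⟨by positivity, ?_⟩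
    nlinarith [mul_nonneg (Real.sqrt_nonneg (quadVar x j))
      (Real.sqrt_nonneg (quadVar (restart x j) l))]
  simp only [restart_succ_sub, Finset.mul_sum] at h
  simp only [neg_mul, mul_assoc, Finset.sum_neg_distrib]
  linarith [runMax_restart_le x j l]

lemma runMax_sub_le (x : ℕ → ℝ) (j l : ℕ) :
    runMax x (j + l) - runMax x j ≤ 18 * √(quadVar x (j + l))
      + ∑ k ∈ Finset.range l,
        2 * integrand (restart x j) k * (x (j + k + 1) - x (j + k)) := by
  have h := runMax_le_sqrt_quadVar (restart_zero x j) l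
  have h1 : √(quadVar (restart x j) l) ≤ √(quadVar x (j + l)) :=
    Real.sqrt_le_sqrt (by rw [quadVar_add]; linarith [quadVar_nonneg x j])
  simp only [restart_succ_sub, Finset.mul_sum] at h
  simp only [mul_assoc]
  linarith [runMax_add_le x j l, Real.sqrt_nonneg (quadVar x (j + l))]

lemma abs_sub_le_sqrt_quadVar (x : ℕ → ℝ) {n N : ℕ} (h : n < N) :
    |x (n + 1) - x n| ≤ √(quadVar x N) := by
  refine Real.abs_le_sqrt ?_
  exact Finset.single_le_sum (f := fun i => (x (i + 1) - x i) ^ 2) (fun _ _ => sq_nonneg _)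
    (Finset.mem_range.mpr h)

lemma abs_sub_le_runMax (x : ℕ → ℝ) {n N : ℕ} (h : n < N) :
    |x (n + 1) - x n| ≤ 2 * runMax x N :=
  (abs_sub _ _).trans (by
    linarith [abs_le_runMax x (show n + 1 ≤ N from h), abs_le_runMax x h.le])

lemma runMax_le_mul_sqrt_quadVar {x : ℕ → ℝ} (hx : x 0 = 0) (N : ℕ) :
    runMax x N ≤ N * √(quadVar x N) := by
  refine runMax_le fun n hn => ?_
  have e : x n = ∑ i ∈ Finset.range n, (x (i + 1) - x i) := by
    rw [Finset.sum_range_sub, hx, sub_zero]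
  calc |x n| ≤ ∑ i ∈ Finset.range n, |x (i + 1) - x i| := by
        conv_lhs => rw [e]
        exact Finset.abs_sum_le_sum_abs _ _
    _ ≤ ∑ i ∈ Finset.range n, √(quadVar x N) := Finset.sum_le_sum fun i hi =>
        abs_sub_le_sqrt_quadVar x ((Finset.mem_range.mp hi).trans_le hn)
    _ = n * √(quadVar x N) := by simp
    _ ≤ N * √(quadVar x N) := by gcongr

lemma sqrt_quadVar_le_mul_runMax (x : ℕ → ℝ) (N : ℕ) :
    √(quadVar x N) ≤ (2 * N) * runMax x N := by
  have hM := runMax_nonneg x N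
  refine Real.sqrt_le_iff.mpr ⟨by positivity, ?_⟩
  calc quadVar x N ≤ ∑ i ∈ Finset.range N, (2 * runMax x N) ^ 2 :=
        Finset.sum_le_sum fun i hi => by
          rw [← sq_abs]
          exact pow_le_pow_left₀ (abs_nonneg _) (abs_sub_le_runMax x (Finset.mem_range.mp hi)) 2
    _ = N * (2 * runMax x N) ^ 2 := by simp
    _ ≤ (N : ℝ) ^ 2 * (2 * runMax x N) ^ 2 := by
        gcongr
        exact_mod_cast Nat.le_self_pow two_ne_zero N
    _ = ((2 * N) * runMax x N) ^ 2 := by ring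

lemma quadVar_eq_sum_Icc (x : ℕ → ℝ) (N : ℕ) :
    ∑ k ∈ Finset.Icc 1 N, (x k - x (k - 1)) ^ 2 = quadVar x N := by
  induction N with
  | zero => simp [quadVar]
  | succ N ih => rw [Finset.sum_Icc_succ_top (by lia), ih, quadVar_succ, Nat.add_sub_cancel]

section Measurability

variable {Ω : Type*} {m : MeasurableSpace Ω} {X : ℕ → Ω → ℝ}

lemma measurable_quadVar {n : ℕ} (hX : ∀ i ≤ n, Measurable (X i)) :
    Measurable fun ω => quadVar (fun i => X i ω) n :=
  Finset.measurable_fun_sum _ fun i hi => by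
    have hi' := Finset.mem_range.mp hi
    exact ((hX _ hi').sub (hX _ hi'.le)).pow_const 2

lemma measurable_runMax {n : ℕ} (hX : ∀ i ≤ n, Measurable (X i)) :
    Measurable fun ω => runMax (fun i => X i ω) n := by
  induction n with
  | zero => exact (hX 0 le_rfl).abs
  | succ n ih => exact (ih fun i hi => hX i (hi.trans n.le_succ)).max (hX _ le_rfl).abs

lemma measurable_integrand {n : ℕ} (hX : ∀ i ≤ n, Measurable (X i)) :
    Measurable fun ω => integrand (fun i => X i ω) n :=
  (hX n le_rfl).div ((measurable_quadVar hX).add ((measurable_runMax hX).pow_const 2)).sqrt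

lemma measurable_integrand_restart {j l : ℕ} (hX : ∀ i ≤ j + l, Measurable (X i)) :
    Measurable fun ω => integrand (restart (fun i => X i ω) j) l :=
  measurable_integrand (X := fun i ω => X (j + i) ω - X j ω) fun i hi =>
    (hX _ (by lia)).sub (hX _ (by lia))

end Measurability

lemma rpow_sub_one_mul_self {a p : ℝ} (ha : 0 ≤ a) (hp : 1 ≤ p) : a ^ (p - 1) * a = a ^ p := by
  have h := Real.rpow_add_of_nonneg ha (sub_nonneg.mpr hp) zero_le_one
  rwa [Real.rpow_one, sub_add_cancel, eq_comm] at h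

lemma rpow_sub_one_mul_le {a b p : ℝ} (ha : 0 ≤ a) (hb : 0 ≤ b) (hp : 1 ≤ p) :
    a ^ (p - 1) * b ≤ a ^ p + b ^ p := by
  have ha' := Real.rpow_nonneg ha p
  have hb' := Real.rpow_nonneg hb p
  rcases le_total a b with h | h
  · have h1 : a ^ (p - 1) * b ≤ b ^ (p - 1) * b := by gcongr
    rw [rpow_sub_one_mul_self hb hp] at h1
    linarith
  · have h1 : a ^ (p - 1) * b ≤ a ^ (p - 1) * a := by gcongr
    rw [rpow_sub_one_mul_self ha hp] at h1
    linarith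

/-- The tangent inequality for the convex function `t ↦ t ^ p`. -/
lemma rpow_le_rpow_add_tangent {a b p : ℝ} (hb : 0 ≤ b) (hba : b ≤ a) (hp : 1 ≤ p) :
    a ^ p ≤ b ^ p + p * (a ^ (p - 1) * (a - b)) := by
  rcases (hb.trans hba).eq_or_lt with h0 | hpos
  · obtain rfl : b = a := by linarith
    simp
  have h := one_add_mul_self_le_rpow_one_add (s := b / a - 1)
    (by linarith [div_nonneg hb hpos.le]) hp
  rw [add_sub_cancel, Real.div_rpow hb hpos.le, le_div_iff₀ (by positivity)] at h
  have e : (1 + p * (b / a - 1)) * a ^ p = a ^ p - p * (a ^ (p - 1) * (a - b)) := by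
    rw [← rpow_sub_one_mul_self hpos.le hp]
    field_simp
    ring
  linarith

lemma rpow_sub_one_mul_le_half_add {a b C p : ℝ} (ha : 0 ≤ a) (hb : 0 ≤ b) (hC : 0 ≤ C)
    (hp : 1 ≤ p) : C * (a ^ (p - 1) * b) ≤ a ^ p / 2 + (2 * C) ^ p * b ^ p := by
  have hCb : 0 ≤ 2 * C * b := by positivity
  rw [← Real.mul_rpow (by positivity) hb]
  have hCbp := Real.rpow_nonneg hCb p
  rcases le_total (2 * C * b) a with h | h
  · have h1 : a ^ (p - 1) * (2 * C * b) ≤ a ^ (p - 1) * a := by gcongr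
    rw [rpow_sub_one_mul_self ha hp] at h1
    linarith
  · have h1 : a ^ (p - 1) * (2 * C * b) ≤ (2 * C * b) ^ (p - 1) * (2 * C * b) := by
      gcongr
    rw [rpow_sub_one_mul_self hCb hp] at h1
    linarith [Real.rpow_nonneg ha p]

/-- The weights in Garsia's lemma: `a ^ (p - 1)`, started from `0`. -/
noncomputable def garsiaWeight (p : ℝ) (a : ℕ → ℝ) (n : ℕ) : ℝ :=
  if n = 0 then 0 else a n ^ (p - 1)

lemma garsiaWeight_nonneg {p : ℝ} {a : ℕ → ℝ} (ha : ∀ n, 0 ≤ a n) (n : ℕ) :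
    0 ≤ garsiaWeight p a n := by
  unfold garsiaWeight
  split_ifs
  · exact le_rfl
  · exact Real.rpow_nonneg (ha n) _

lemma garsiaWeight_le {p : ℝ} {a : ℕ → ℝ} (ha : ∀ n, 0 ≤ a n) (n : ℕ) :
    garsiaWeight p a n ≤ a n ^ (p - 1) := by
  unfold garsiaWeight
  split_ifs
  · exact Real.rpow_nonneg (ha n) _
  · exact le_rfl

lemma garsiaWeight_mono {p : ℝ} (hp : 1 ≤ p) {a : ℕ → ℝ} (ha : ∀ n, 0 ≤ a n)
    (hmono : Monotone a) : Monotone (garsiaWeight p a) := by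
  refine monotone_nat_of_le_succ fun n => (garsiaWeight_le ha n).trans ?_
  rw [garsiaWeight, if_neg n.succ_ne_zero]
  exact Real.rpow_le_rpow (ha n) (hmono n.le_succ) (by linarith)

lemma rpow_le_sum_garsiaWeight {p : ℝ} (hp : 1 ≤ p) {a : ℕ → ℝ} (ha0 : a 0 = 0)
    (ha : ∀ n, 0 ≤ a n) (hmono : Monotone a) (N : ℕ) :
    a N ^ p ≤ p * ∑ j ∈ Finset.range N,
      (garsiaWeight p a (j + 1) - garsiaWeight p a j) * (a N - a j) := by
  induction N with
  | zero => simp [ha0, Real.zero_rpow (by linarith : p ≠ 0)]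
  | succ N ih =>
    have h1 := rpow_le_rpow_add_tangent (ha N) (hmono N.le_succ) hp
    have h2 : ∑ j ∈ Finset.range (N + 1),
        (garsiaWeight p a (j + 1) - garsiaWeight p a j) * (a (N + 1) - a j)
        = ∑ j ∈ Finset.range N, (garsiaWeight p a (j + 1) - garsiaWeight p a j) * (a N - a j)
          + a (N + 1) ^ (p - 1) * (a (N + 1) - a N) := by
      have h3 : ∀ j, (garsiaWeight p a (j + 1) - garsiaWeight p a j) * (a (N + 1) - a j)
          = (garsiaWeight p a (j + 1) - garsiaWeight p a j) * (a N - a j)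
            + (garsiaWeight p a (j + 1) - garsiaWeight p a j) * (a (N + 1) - a N) :=
        fun j => by ring
      simp_rw [h3]
      rw [Finset.sum_add_distrib, ← Finset.sum_mul, Finset.sum_range_sub, Finset.sum_range_succ]
      simp [garsiaWeight]
    rw [h2]
    linarith

/-- The expectation of a martingale increment against a past weight vanishes. -/
lemma integral_mul_increment_eq_zero {Ω : Type*} {m0 : MeasurableSpace Ω} {μ : Measure Ω}
    [IsFiniteMeasure μ] {ℱ : Filtration ℕ m0} {X : ℕ → Ω → ℝ} (hX : Martingale X ℱ μ) {n : ℕ}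
    {G : Ω → ℝ} (hG : StronglyMeasurable[ℱ n] G)
    (hint : Integrable (fun ω => G ω * (X (n + 1) ω - X n ω)) μ) :
    ∫ ω, G ω * (X (n + 1) ω - X n ω) ∂μ = 0 := by
  have h1 : μ[X (n + 1) - X n | ℱ n] =ᵐ[μ] 0 := by
    have h2 := condExp_sub (hX.integrable (n + 1)) (hX.integrable n) (ℱ n)
    filter_upwards [h2, hX.condExp_ae_eq n.le_succ, hX.condExp_ae_eq (le_refl n)] with ω a b c
    rw [a, Pi.sub_apply, b, c, sub_self, Pi.zero_apply]
  have h3 := condExp_mul_of_stronglyMeasurable_left (m := ℱ n) (μ := μ) (f := G)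
    (g := X (n + 1) - X n) hG hint ((hX.integrable _).sub (hX.integrable _))
  rw [← integral_condExp (ℱ.le n)]
  refine integral_eq_zero_of_ae ?_
  filter_upwards [h1, h3] with ω a b
  refine b.trans ?_
  rw [Pi.mul_apply, a, Pi.zero_apply, mul_zero]

/-- **Garsia's lemma**, with the conditional domination of the increments `A N - A j` of an
increasing process expressed through martingale transforms. -/
lemma lintegral_rpow_le_of_increment_le {p : ℝ} (hp : 1 ≤ p) {Ω : Type*}
    {m0 : MeasurableSpace Ω} {μ : Measure Ω} [IsProbabilityMeasure μ] {ℱ : Filtration ℕ m0}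
    {X : ℕ → Ω → ℝ} (hX : Martingale X ℱ μ) {A : ℕ → Ω → ℝ}
    (hA : ∀ n, Measurable[ℱ n] (A n)) (hA0 : ∀ ω, A 0 ω = 0)
    (hmono : ∀ ω, Monotone fun n => A n ω) {B : Ω → ℝ} (hB : Measurable B)
    (hB0 : ∀ ω, 0 ≤ B ω) {h : ℕ → ℕ → Ω → ℝ} (hh : ∀ j l, Measurable[ℱ (j + l)] (h j l))
    (hh0 : ∀ j ω, h j 0 ω = 0) (hh2 : ∀ j l ω, |h j l ω| ≤ 2) {N : ℕ} {C K : ℝ} (hC : 0 < C)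
    (hle : ∀ j l ω, j + l = N → A N ω - A j ω ≤ C * B ω
      + ∑ k ∈ Finset.range l, h j k ω * (X (j + k + 1) ω - X (j + k) ω))
    (hK : 0 ≤ K) (hAB : ∀ ω, A N ω ≤ K * B ω)
    (hXB : ∀ n < N, ∀ ω, |X (n + 1) ω - X n ω| ≤ K * B ω) :
    ∫⁻ ω, ENNReal.ofReal (A N ω ^ p) ∂μ
      ≤ ENNReal.ofReal (2 * (2 * (p * C)) ^ p) * ∫⁻ ω, ENNReal.ofReal (B ω ^ p) ∂μ := by
  have hp0 : 0 < p := by linarith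
  have hBp0 : ∀ ω, 0 ≤ B ω ^ p := fun ω => Real.rpow_nonneg (hB0 ω) p
  have hAnn : ∀ ω n, 0 ≤ A n ω := fun ω n => (hA0 ω).symm.le.trans (hmono ω (Nat.zero_le n))
  have hAp0 : ∀ ω, 0 ≤ A N ω ^ p := fun ω => Real.rpow_nonneg (hAnn ω N) p
  by_cases htop : ∫⁻ ω, ENNReal.ofReal (B ω ^ p) ∂μ = ∞
  · rw [htop, ENNReal.mul_top (by rw [Ne, ENNReal.ofReal_eq_zero, not_le]; positivity)]
    exact le_top
  have hBint : Integrable (fun ω => B ω ^ p) μ :=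
    ⟨(hB.pow_const p).aestronglyMeasurable, by
      rw [hasFiniteIntegral_iff_ofReal (ae_of_all _ hBp0)]; exact lt_top_iff_ne_top.mpr htop⟩
  have hAint : Integrable (fun ω => A N ω ^ p) μ := by
    refine (hBint.const_mul (K ^ p)).mono'
      (((hA N).mono (ℱ.le N) le_rfl).pow_const p).aestronglyMeasurable (ae_of_all _ fun ω => ?_)
    rw [Real.norm_of_nonneg (hAp0 ω), ← Real.mul_rpow hK (hB0 ω)]
    exact Real.rpow_le_rpow (hAnn ω N) (hAB ω) hp0.le
  let w : ℕ → Ω → ℝ := fun j ω =>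
    garsiaWeight p (fun n => A n ω) (j + 1) - garsiaWeight p (fun n => A n ω) j
  have hgmeas : ∀ n, Measurable[ℱ n] fun ω => garsiaWeight p (fun n => A n ω) n := by
    intro n
    unfold garsiaWeight
    split_ifs
    · exact measurable_const
    · exact (hA n).pow_const _
  have hwmeas : ∀ j, Measurable[ℱ (j + 1)] (w j) := fun j =>
    (hgmeas (j + 1)).sub ((hgmeas j).mono (ℱ.mono j.le_succ) le_rfl)
  have hw0 : ∀ j ω, 0 ≤ w j ω := fun j ω =>
    sub_nonneg.mpr (garsiaWeight_mono hp (hAnn ω) (hmono ω) j.le_succ)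
  have hwle : ∀ j < N, ∀ ω, w j ω ≤ A N ω ^ (p - 1) := by
    intro j hj ω
    have h1 := garsiaWeight_nonneg (p := p) (hAnn ω) j
    have h2 := garsiaWeight_mono hp (hAnn ω) (hmono ω) (show j + 1 ≤ N from hj)
    have h3 := garsiaWeight_le (p := p) (hAnn ω) N
    simp only [w]
    linarith
  have hterm : ∀ j k, j + k < N →
      Integrable (fun ω => (w j ω * h j k ω) * (X (j + k + 1) ω - X (j + k) ω)) μ ∧
      ∫ ω, (w j ω * h j k ω) * (X (j + k + 1) ω - X (j + k) ω) ∂μ = 0 := by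
    intro j k hjk
    rcases Nat.eq_zero_or_pos k with rfl | hk
    · simp [hh0]
    have hG : Measurable[ℱ (j + k)] fun ω => w j ω * h j k ω :=
      ((hwmeas j).mono (ℱ.mono (by lia)) le_rfl).mul (hh j k)
    have hGX : Integrable (fun ω => (w j ω * h j k ω) * (X (j + k + 1) ω - X (j + k) ω)) μ := by
      refine ((hAint.add (hBint.const_mul (K ^ p))).const_mul 2).mono'
        ((hG.mono (ℱ.le _) le_rfl).aestronglyMeasurable.mul
          ((hX.integrable _).sub (hX.integrable _)).aestronglyMeasurable)
        (ae_of_all _ fun ω => ?_)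
      have hKB : 0 ≤ K * B ω := mul_nonneg hK (hB0 ω)
      rw [Real.norm_eq_abs, abs_mul, abs_mul, abs_of_nonneg (hw0 j ω)]
      calc w j ω * |h j k ω| * |X (j + k + 1) ω - X (j + k) ω|
          ≤ A N ω ^ (p - 1) * 2 * (K * B ω) := by
            have := hw0 j ω
            have := Real.rpow_nonneg (hAnn ω N) (p - 1)
            gcongr
            · exact hwle j (by lia) ω
            · exact hh2 j k ω
            · exact hXB _ hjk ω
        _ = 2 * (A N ω ^ (p - 1) * (K * B ω)) := by ring
        _ ≤ 2 * (A N ω ^ p + (K * B ω) ^ p) := by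
            gcongr
            exact rpow_sub_one_mul_le (hAnn ω N) hKB hp
        _ = _ := by rw [Real.mul_rpow hK (hB0 ω)]; rfl
    exact ⟨hGX, integral_mul_increment_eq_zero hX hG.stronglyMeasurable hGX⟩
  let Z : Ω → ℝ := fun ω => ∑ j ∈ Finset.range N, ∑ k ∈ Finset.range (N - j),
    (w j ω * h j k ω) * (X (j + k + 1) ω - X (j + k) ω)
  have hlt : ∀ {j k}, j ∈ Finset.range N → k ∈ Finset.range (N - j) → j + k < N := by
    intro j k hj hk
    rw [Finset.mem_range] at hj hk
    lia
  have hZint : Integrable Z μ := integrable_finsetSum _ fun j hj =>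
    integrable_finsetSum _ fun k hk => (hterm j k (hlt hj hk)).1
  have hZ0 : ∫ ω, Z ω ∂μ = 0 := by
    rw [integral_finsetSum _ fun j hj =>
      integrable_finsetSum _ fun k hk => (hterm j k (hlt hj hk)).1]
    refine Finset.sum_eq_zero fun j hj => ?_
    rw [integral_finsetSum _ fun k hk => (hterm j k (hlt hj hk)).1]
    exact Finset.sum_eq_zero fun k hk => (hterm j k (hlt hj hk)).2
  have hpath : ∀ ω, A N ω ^ p ≤ 2 * (2 * (p * C)) ^ p * B ω ^ p + 2 * p * Z ω := by
    intro ω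
    have h1 := rpow_le_sum_garsiaWeight hp (hA0 ω) (hAnn ω) (hmono ω) N
    have h2 : ∑ j ∈ Finset.range N, w j ω * (A N ω - A j ω)
        ≤ ∑ j ∈ Finset.range N, (w j ω * (C * B ω) + ∑ k ∈ Finset.range (N - j),
          (w j ω * h j k ω) * (X (j + k + 1) ω - X (j + k) ω)) := by
      refine Finset.sum_le_sum fun j hj => ?_
      have h3 := mul_le_mul_of_nonneg_left
        (hle j (N - j) ω (by have := Finset.mem_range.mp hj; lia)) (hw0 j ω)
      rw [mul_add, Finset.mul_sum] at h3
      simpa only [mul_assoc] using h3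
    have h4 : ∑ j ∈ Finset.range N, w j ω ≤ A N ω ^ (p - 1) := by
      simp only [w]
      rw [Finset.sum_range_sub]
      have := garsiaWeight_le (p := p) (hAnn ω) N
      have := garsiaWeight_nonneg (p := p) (hAnn ω) 0
      linarith
    rw [Finset.sum_add_distrib, ← Finset.sum_mul] at h2
    have h5 := mul_le_mul_of_nonneg_right h4 (mul_nonneg hC.le (hB0 ω))
    have h6 := rpow_sub_one_mul_le_half_add (hAnn ω N) (hB0 ω) (mul_nonneg hp0.le hC.le) hp
    have h7 : A N ω ^ p ≤ p * (A N ω ^ (p - 1) * (C * B ω) + Z ω) :=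
      h1.trans (mul_le_mul_of_nonneg_left (by simp only [w, Z] at *; linarith) hp0.le)
    linarith
  have hintegral : ∫ ω, A N ω ^ p ∂μ ≤ 2 * (2 * (p * C)) ^ p * ∫ ω, B ω ^ p ∂μ := by
    calc ∫ ω, A N ω ^ p ∂μ ≤ ∫ ω, (2 * (2 * (p * C)) ^ p * B ω ^ p + 2 * p * Z ω) ∂μ :=
          integral_mono hAint ((hBint.const_mul _).add (hZint.const_mul _)) hpath
      _ = _ := by
          rw [integral_add (hBint.const_mul _) (hZint.const_mul _), integral_const_mul,
            integral_const_mul, hZ0, mul_zero, add_zero]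
  rw [← ofReal_integral_eq_lintegral_ofReal hAint (ae_of_all _ hAp0),
    ← ofReal_integral_eq_lintegral_ofReal hBint (ae_of_all _ hBp0),
    ← ENNReal.ofReal_mul (by positivity)]
  exact ENNReal.ofReal_le_ofReal hintegral

end BurkholderDavisGundy

open BurkholderDavisGundy in
/-- **Burkholder–Davis–Gundy inequalities** (discrete time). For every `p ∈ [1, ∞)`
there are constants `0 < c_p ≤ C_p < ∞`, depending only on `p`, such that for every
discrete-time martingale `X` with `X 0 = 0` and every `N`,
`c_p · E[S_N^p] ≤ E[(max_{n ≤ N} |X_n|)^p] ≤ C_p · E[S_N^p]`,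
where `S_N = (∑_{k=1}^N (X_k - X_{k-1})²)^{1/2}`. -/
theorem burkholder_davis_gundy (p : ℝ) (hp : 1 ≤ p) :
    ∃ c C : ℝ, 0 < c ∧ c ≤ C ∧
      ∀ (Ω : Type*) (m0 : MeasurableSpace Ω) (μ : Measure Ω), IsProbabilityMeasure μ →
        ∀ (ℱ : Filtration ℕ m0) (X : ℕ → Ω → ℝ), Martingale X ℱ μ →
          (∀ ω, X 0 ω = 0) → ∀ N : ℕ,
            ENNReal.ofReal c *
                ∫⁻ ω, ENNReal.ofReal
                  (Real.sqrt (∑ k ∈ Finset.Icc 1 N, (X k ω - X (k - 1) ω) ^ 2) ^ p) ∂μ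
              ≤ ∫⁻ ω, ENNReal.ofReal ((⨆ n ∈ Set.Iic N, |X n ω|) ^ p) ∂μ ∧
            ∫⁻ ω, ENNReal.ofReal ((⨆ n ∈ Set.Iic N, |X n ω|) ^ p) ∂μ
              ≤ ENNReal.ofReal C *
                ∫⁻ ω, ENNReal.ofReal
                  (Real.sqrt (∑ k ∈ Finset.Icc 1 N, (X k ω - X (k - 1) ω) ^ 2) ^ p) ∂μ := by
  have hp0 : 0 < p := by linarith
  let K : ℝ := 2 * (2 * (p * 18)) ^ p
  have hK1 : 1 ≤ K := by
    have : 1 ≤ (2 * (p * 18)) ^ p := Real.one_le_rpow (by linarith) hp0.le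
    simp only [K]
    linarith
  have hK0 : 0 < K := by linarith
  refine ⟨K⁻¹, K, by positivity, (inv_le_one_of_one_le₀ hK1).trans hK1, ?_⟩
  intro Ω m0 μ _ ℱ X hX hX0 N
  simp only [iSup_abs_eq_runMax (fun n => X n _) N, quadVar_eq_sum_Icc (fun n => X n _) N]
  have hXmeas : ∀ n, ∀ i ≤ n, Measurable[ℱ n] (X i) := fun n i hi =>
    (hX.stronglyMeasurable i).measurable.mono (ℱ.mono hi) le_rfl
  have hSmeas : ∀ n, Measurable[ℱ n] fun ω => √(quadVar (fun i => X i ω) n) := fun n =>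
    (measurable_quadVar (hXmeas n)).sqrt
  have hMmeas : ∀ n, Measurable[ℱ n] fun ω => runMax (fun i => X i ω) n := fun n =>
    measurable_runMax (hXmeas n)
  have hhmeas : ∀ j l, Measurable[ℱ (j + l)] fun ω =>
      integrand (restart (fun i => X i ω) j) l := fun j l =>
    measurable_integrand_restart (hXmeas (j + l))
  constructor
  · have hSM := lintegral_rpow_le_of_increment_le hp hX hSmeas (by simp [quadVar])
      (fun ω => fun a b hab => Real.sqrt_le_sqrt (quadVar_mono _ hab))
      ((hMmeas N).mono (ℱ.le N) le_rfl) (fun ω => runMax_nonneg _ _)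
      (h := fun j l ω => -2 * integrand (restart (fun i => X i ω) j) l)
      (fun j l => (hhmeas j l).const_mul (-2)) (by simp)
      (fun j l ω => by
        rw [abs_mul, abs_neg, abs_two]
        linarith [abs_integrand_le_one (restart (fun i => X i ω) j) l])
      (N := N) (C := 18) (K := 2 * N + 2) (by norm_num)
      (fun j l ω hjl => by
        subst hjl
        exact sqrt_quadVar_sub_le (fun i => X i ω) j l)
      (by positivity)
      (fun ω => (sqrt_quadVar_le_mul_runMax (fun i => X i ω) N).trans
        (mul_le_mul_of_nonneg_right (by linarith) (runMax_nonneg _ _)))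
      (fun n hn ω => (abs_sub_le_runMax (fun i => X i ω) hn).trans
        (mul_le_mul_of_nonneg_right (by linarith [N.cast_nonneg (α := ℝ)])
          (runMax_nonneg _ _)))
    calc _ ≤ ENNReal.ofReal K⁻¹ * (ENNReal.ofReal K * _) := by gcongr
      _ = _ := by
        rw [← mul_assoc, ← ENNReal.ofReal_mul (by positivity), inv_mul_cancel₀ hK0.ne',
          ENNReal.ofReal_one, one_mul]
  · exact lintegral_rpow_le_of_increment_le hp hX hMmeas (by simp [runMax, hX0])
      (fun ω => runMax_mono _)
      ((hSmeas N).mono (ℱ.le N) le_rfl) (fun ω => Real.sqrt_nonneg _)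
      (h := fun j l ω => 2 * integrand (restart (fun i => X i ω) j) l)
      (fun j l => (hhmeas j l).const_mul 2) (by simp)
      (fun j l ω => by
        rw [abs_mul, abs_two]
        linarith [abs_integrand_le_one (restart (fun i => X i ω) j) l])
      (N := N) (C := 18) (K := N + 1) (by norm_num)
      (fun j l ω hjl => by
        subst hjl
        exact runMax_sub_le (fun i => X i ω) j l)
      (by positivity)
      (fun ω => (runMax_le_mul_sqrt_quadVar (x := fun i => X i ω) (hX0 ω) N).trans
        (mul_le_mul_of_nonneg_right (by linarith) (Real.sqrt_nonneg _)))
      (fun n hn ω => (abs_sub_le_sqrt_quadVar (fun i => X i ω) hn).trans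
        (le_mul_of_one_le_left (Real.sqrt_nonneg _) (by linarith [N.cast_nonneg (α := ℝ)])))
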